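/- arXiv:1611.09096 — 2 statements merged into one kernel-verified Lean document; each statement's English description precedes it below -/
import Mathlib

section
/- Let P = {v_0, v_1, …, v_{n−1}} be a set of n ≥ 3 points in convex position in the plane with n even. Then every 1-plane Hamiltonian cycle on P contains at least two boundary edges. -/
open Finset

noncomputable section

/-- The Euclidean plane. -/
abbrev Pt : Type := EuclideanSpace ℝ (Fin 2)

/-- Strict counterclockwise orientation of an ordered triple of points. -/
def Ccw (p q r : Pt) : Prop :=
  0 < (q 0 - p 0) * (r 1 - p 1) - (q 1 - p 1) * (r 0 - p 0)

/-- `v` lists `n` points in convex position, labeled counterclockwise. -/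
def ConvexCcw {n : ℕ} (v : Fin n → Pt) : Prop :=
  ∀ i j k : Fin n, i < j → j < k → Ccw (v i) (v j) (v k)

/-- The open straight-line segment drawn for an unordered pair of indices. -/
def seg {n : ℕ} (v : Fin n → Pt) (e : Sym2 (Fin n)) : Set Pt :=
  Sym2.lift ⟨fun a b => openSegment ℝ (v a) (v b),
    fun a b => openSegment_symm ℝ (v a) (v b)⟩ e

/-- Two drawn edges cross: they share no endpoint and their open segments meet. -/
def EdgesCross {n : ℕ} (v : Fin n → Pt) (e f : Sym2 (Fin n)) : Prop :=
  (∀ a, a ∈ e → a ∉ f) ∧ (seg v e ∩ seg v f).Nonempty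

/-- A set of drawn edges is 1-plane: each edge is crossed by at most one other edge. -/
def OnePlane {n : ℕ} (v : Fin n → Pt) (E : Set (Sym2 (Fin n))) : Prop :=
  ∀ e ∈ E, {f | f ∈ E ∧ EdgesCross v e f}.Subsingleton

/-- `σ` is a Hamiltonian cycle on all `n` vertices. -/
def IsHamCycle {n : ℕ} (σ : Equiv.Perm (Fin n)) : Prop :=
  σ.IsCycle ∧ σ.support = Finset.univ

/-- The edge set of the Hamiltonian cycle `σ`. -/
def cycEdges {n : ℕ} (σ : Equiv.Perm (Fin n)) : Set (Sym2 (Fin n)) :=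
  {e | ∃ i : Fin n, e = s(i, σ i)}

/-- `σ` is a 1-plane Hamiltonian cycle for the point placement `v`. -/
def IsOnePlaneHC {n : ℕ} (v : Fin n → Pt) (σ : Equiv.Perm (Fin n)) : Prop :=
  IsHamCycle σ ∧ OnePlane v (cycEdges σ)

/-- `k` lies on the counterclockwise arc from `j` to `i` (inclusive), indices mod `n`. -/
def InArc {n : ℕ} (j i k : Fin n) : Prop := (k - j).val ≤ (i - j).val

/-- The chords `{a, b}` and `{c, d}` have four distinct endpoints, which interleave. -/
def Interleave (a b c d : ℕ) : Prop :=
  a ≠ c ∧ a ≠ d ∧ b ≠ c ∧ b ≠ d ∧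
    ((min a b < c ∧ c < max a b) ↔ ¬ (min a b < d ∧ d < max a b))

theorem Interleave.symm {a b c d : ℕ} (h : Interleave a b c d) : Interleave c d a b := by
  unfold Interleave at *
  omega

theorem openSegment_inter_nonempty {p q r s : Pt} (hpqr : Ccw p q r) (hpqs : Ccw p q s)
    (hprs : Ccw p r s) (hqrs : Ccw q r s) :
    (openSegment ℝ p r ∩ openSegment ℝ q s).Nonempty := by
  unfold Ccw at *
  set D := (q 0 - p 0) * (r 1 - p 1) - (q 1 - p 1) * (r 0 - p 0) with hD
  set C := (q 0 - p 0) * (s 1 - p 1) - (q 1 - p 1) * (s 0 - p 0) with hC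
  set B := (r 0 - p 0) * (s 1 - p 1) - (r 1 - p 1) * (s 0 - p 0) with hB
  set A := (r 0 - q 0) * (s 1 - q 1) - (r 1 - q 1) * (s 0 - q 0) with hA
  have hsum : A + C = B + D := by rw [hA, hB, hC, hD]; ring
  have hpos : 0 < A + C := by positivity
  have hpos' : 0 < B + D := by positivity
  refine ⟨(A / (A + C)) • p + (C / (A + C)) • r,
    ⟨_, _, by positivity, by positivity, by field_simp, rfl⟩,
    ⟨B / (B + D), D / (B + D), by positivity, by positivity, by field_simp, ?_⟩⟩
  rw [← hsum]
  ext i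
  simp only [PiLp.add_apply, PiLp.smul_apply, smul_eq_mul]
  have key : B * q i + D * s i = A * p i + C * r i := by
    fin_cases i <;> simp only [hA, hB, hC, hD, Fin.zero_eta, Fin.mk_one] <;> ring
  field_simp
  linarith

theorem ConvexCcw.openSegment_inter_nonempty {n : ℕ} {v : Fin n → Pt} (hv : ConvexCcw v)
    {i j k l : Fin n} (hij : i < j) (hjk : j < k) (hkl : k < l) :
    (openSegment ℝ (v i) (v k) ∩ openSegment ℝ (v j) (v l)).Nonempty :=
  _root_.openSegment_inter_nonempty (hv _ _ _ hij hjk) (hv _ _ _ hij (hjk.trans hkl))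
    (hv _ _ _ (hij.trans hjk) hkl) (hv _ _ _ hjk hkl)

theorem ConvexCcw.edgesCross_of_interleave {n : ℕ} {v : Fin n → Pt} (hv : ConvexCcw v)
    {a b c d : Fin n} (h : Interleave a b c d) : EdgesCross v s(a, b) s(c, d) := by
  obtain ⟨hac, had, hbc, hbd, hiff⟩ := h
  constructor
  · intro x hx hx'
    rw [Sym2.mem_iff] at hx hx'
    rcases hx with rfl | rfl <;> rcases hx' with rfl | rfl <;> contradiction
  · change (openSegment ℝ (v a) (v b) ∩ openSegment ℝ (v c) (v d)).Nonempty
    wlog hab : a < b generalizing a b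
    · rw [openSegment_symm]
      exact this hbc hbd hac had (by omega) (by omega)
    wlog hcd : c < d generalizing c d
    · rw [openSegment_symm ℝ (v c)]
      exact this had hac hbd hbc (by omega) (by omega)
    by_cases h : a < c
    · exact hv.openSegment_inter_nonempty h (by omega) (by omega)
    · rw [Set.inter_comm]
      exact hv.openSegment_inter_nonempty (by omega) (by omega) (by omega)

theorem Fin.val_add_one_eq_ite {n : ℕ} [NeZero n] (hn : 2 ≤ n) (k : Fin n) :
    (k + 1).val = if k.val + 1 = n then 0 else k.val + 1 := by
  have h1 : (1 : Fin n).val = 1 := by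
    rw [Fin.val_one', Nat.mod_eq_of_lt hn]
  rw [Fin.val_add_eq_ite, h1]
  split_ifs <;> omega

theorem exists_eq_boundary {n : ℕ} [NeZero n] (hn : 2 ≤ n) {a b : Fin n}
    (h : max a.val b.val = min a.val b.val + 1 ∨ (min a.val b.val = 0 ∧ max a.val b.val + 1 = n)) :
    ∃ k : Fin n, s(a, b) = s(k, k + 1) := by
  have ha := Fin.val_add_one_eq_ite hn a
  have hb := Fin.val_add_one_eq_ite hn b
  have : b = a + 1 ∨ a = b + 1 := by
    rw [Fin.ext_iff, Fin.ext_iff, ha, hb]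
    split_ifs <;> omega
  rcases this with h | h
  · exact ⟨a, by rw [← h]⟩
  · exact ⟨b, by rw [← h, Sym2.eq_swap]⟩

theorem not_interleave_of_eq_boundary {n : ℕ} [NeZero n] (hn : 2 ≤ n) {a b k c d : Fin n}
    (h : s(a, b) = s(k, k + 1)) : ¬ Interleave a b c d := by
  have hk := Fin.val_add_one_eq_ite hn k
  unfold Interleave
  rw [Sym2.eq_iff] at h
  rcases h with ⟨rfl, rfl⟩ | ⟨rfl, rfl⟩ <;> rw [hk] <;> split_ifs <;> omega

namespace IsHamCycle

variable {n : ℕ} {σ : Equiv.Perm (Fin n)}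

theorem apply_ne (h : IsHamCycle σ) (i : Fin n) : σ i ≠ i := by
  have : i ∈ σ.support := by rw [h.2]; exact mem_univ i
  exact Equiv.Perm.mem_support.1 this

theorem mem_of_closed (h : IsHamCycle σ) {p : Fin n → Prop} {a : Fin n} (ha : p a)
    (hp : ∀ x, p x → p (σ x)) (x : Fin n) : p x := by
  obtain ⟨k, rfl⟩ := h.1.exists_pow_eq (h.apply_ne a) (h.apply_ne x)
  induction k with
  | zero => simpa using ha
  | succ k ih =>
    rw [pow_succ', Equiv.Perm.mul_apply]
    exact hp _ ih

theorem apply_apply_ne (h : IsHamCycle σ) (hn : 3 ≤ n) (i : Fin n) : σ (σ i) ≠ i := by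
  intro hi
  have hall : ∀ x, x ∈ ({i, σ i} : Finset (Fin n)) :=
    h.mem_of_closed (a := i) (by simp) (by
      intro x hx
      rw [mem_insert, mem_singleton] at hx ⊢
      rcases hx with rfl | rfl
      · exact Or.inr rfl
      · exact Or.inl hi)
  have hcard := card_le_two (a := i) (b := σ i)
  rw [eq_univ_iff_forall.2 hall, card_univ, Fintype.card_fin] at hcard
  omega

theorem edge_injective (h : IsHamCycle σ) (hn : 3 ≤ n) :
    Function.Injective fun i => s(i, σ i) := by
  intro i j hij
  rcases Sym2.eq_iff.1 hij with h' | ⟨h1, h2⟩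
  · exact h'.1
  · exact (h.apply_apply_ne hn j (by rw [← h1, h2])).elim

/-- An edge that is not on the boundary separates the remaining vertices, so it is crossed. -/
theorem exists_interleave [NeZero n] (h : IsHamCycle σ) (hn : 3 ≤ n) {i : Fin n}
    (hi : ∀ k : Fin n, s(i, σ i) ≠ s(k, k + 1)) :
    ∃ j : Fin n, Interleave i (σ i) j (σ j) := by
  by_contra! hno
  have hbd := mt (exists_eq_boundary (by omega : 2 ≤ n)) (not_exists.2 hi)
  have hne : i.val ≠ (σ i).val := fun e => h.apply_ne i (Fin.ext e.symm)
  have hout : ∃ y : Fin n, y ≠ i ∧ y ≠ σ i ∧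
      ¬ (min i.val (σ i).val < y.val ∧ y.val < max i.val (σ i).val) := by
    by_cases h0 : min i.val (σ i).val = 0
    · exact ⟨⟨n - 1, by omega⟩, by rw [Ne, Fin.ext_iff]; dsimp only; omega,
        by rw [Ne, Fin.ext_iff]; dsimp only; omega, by dsimp only; omega⟩
    · exact ⟨⟨0, by omega⟩, by rw [Ne, Fin.ext_iff]; dsimp only; omega,
        by rw [Ne, Fin.ext_iff]; dsimp only; omega, by dsimp only; omega⟩
  have hin : ∃ y : Fin n, min i.val (σ i).val < y.val ∧ y.val < max i.val (σ i).val :=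
    ⟨⟨min i.val (σ i).val + 1, by omega⟩, by dsimp only; omega, by dsimp only; omega⟩
  have hall := h.mem_of_closed (a := i)
    (p := fun x => x = i ∨ x = σ i ∨
      ((min i.val (σ i).val < x.val ∧ x.val < max i.val (σ i).val) ↔
        (min i.val (σ i).val < (σ (σ i)).val ∧ (σ (σ i)).val < max i.val (σ i).val)))
    (Or.inl rfl) (by
      rintro x (rfl | rfl | hx)
      · exact Or.inr (Or.inl rfl)
      · exact Or.inr (Or.inr Iff.rfl)
      · by_cases h1 : x = i
        · exact Or.inr (Or.inl (congrArg σ h1))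
        by_cases h2 : x = σ i
        · exact Or.inr (Or.inr (by rw [h2]))
        by_cases h3 : σ x = i
        · exact Or.inl h3
        by_cases h4 : σ x = σ i
        · exact Or.inr (Or.inl h4)
        refine Or.inr (Or.inr ?_)
        have hx' := hno x
        rw [Fin.ext_iff] at h1 h2 h3 h4
        unfold Interleave at hx'
        omega)
  obtain ⟨y, hy1, hy2, hy3⟩ := hout
  obtain ⟨z, hz⟩ := hin
  have hy := hall y
  have hz' := hall z
  rw [Ne, Fin.ext_iff] at hy1 hy2
  rw [Fin.ext_iff, Fin.ext_iff] at hy hz'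
  omega

end IsHamCycle

namespace IsOnePlaneHC

variable {n : ℕ} {v : Fin n → Pt} {σ : Equiv.Perm (Fin n)}

theorem eq_of_interleave (hC : IsOnePlaneHC v σ) (hv : ConvexCcw v) (hn : 3 ≤ n) {i j k : Fin n}
    (hj : Interleave i (σ i) j (σ j)) (hk : Interleave i (σ i) k (σ k)) : j = k :=
  hC.1.edge_injective hn <| hC.2 s(i, σ i) ⟨i, rfl⟩
    ⟨⟨j, rfl⟩, hv.edgesCross_of_interleave hj⟩ ⟨⟨k, rfl⟩, hv.edgesCross_of_interleave hk⟩

/-- A shortest edge lies on the boundary: otherwise both edges at the vertex next to one of its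
endpoints would cross it. -/
theorem exists_boundary [NeZero n] (hC : IsOnePlaneHC v σ) (hv : ConvexCcw v) (hn : 3 ≤ n) :
    ∃ i k : Fin n, s(i, σ i) = s(k, k + 1) := by
  obtain ⟨i, -, hmin⟩ := exists_min_image univ
    (fun i : Fin n => max i.val (σ i).val - min i.val (σ i).val) univ_nonempty
  refine ⟨i, ?_⟩
  by_contra hi
  have hbd := mt (exists_eq_boundary (by omega : 2 ≤ n)) hi
  have hne : i.val ≠ (σ i).val := fun e => hC.1.apply_ne i (Fin.ext e.symm)
  obtain ⟨w, hw⟩ : ∃ w : Fin n, w.val = min i.val (σ i).val + 1 :=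
    ⟨⟨min i.val (σ i).val + 1, by omega⟩, rfl⟩
  obtain ⟨u, rfl⟩ := σ.surjective w
  have hu := hmin u (mem_univ _)
  have hw' := hmin (σ u) (mem_univ _)
  have hne1 : u.val ≠ (σ u).val := fun e => hC.1.apply_ne u (Fin.ext e.symm)
  have hne2 : (σ u).val ≠ (σ (σ u)).val := fun e => hC.1.apply_ne (σ u) (Fin.ext e.symm)
  have h1 : Interleave i (σ i) u (σ u) := by
    unfold Interleave
    omega
  have h2 : Interleave i (σ i) (σ u) (σ (σ u)) := by
    unfold Interleave
    omega
  exact hC.1.apply_ne u (hC.eq_of_interleave hv hn h1 h2).symm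

end IsOnePlaneHC

/-- every 1-plane Hamiltonian cycle on `n ≥ 3` points in convex
position, with `n` even, contains at least two boundary edges. -/
theorem stmt2 {n : ℕ} [NeZero n] (hn : 3 ≤ n) (heven : Even n)
    (v : Fin n → Pt) (hconv : ConvexCcw v)
    (σ : Equiv.Perm (Fin n)) (hC : IsOnePlaneHC v σ) :
    ∃ k l : Fin n, k ≠ l ∧ s(k, k + 1) ∈ cycEdges σ ∧ s(l, l + 1) ∈ cycEdges σ := by
  obtain ⟨i₀, k₀, h₀⟩ := hC.exists_boundary hconv hn
  by_contra! hcon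
  have huniq : ∀ i k : Fin n, s(i, σ i) = s(k, k + 1) → i = i₀ := by
    intro i k hik
    have hk : k = k₀ := by
      by_contra hne
      exact hcon k k₀ hne ⟨i, hik.symm⟩ ⟨i₀, h₀.symm⟩
    subst hk
    exact hC.1.edge_injective hn (hik.trans h₀.symm)
  have hex : ∀ i, i ≠ i₀ → ∃ j : Fin n, Interleave i (σ i) j (σ j) := fun i hi =>
    hC.1.exists_interleave hn fun k hk => hi (huniq i k hk)
  choose! g hg using hex
  have hg₀ : ∀ i, i ≠ i₀ → g i ≠ i₀ := fun i hi e =>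
    not_interleave_of_eq_boundary (by omega : 2 ≤ n) h₀ (e ▸ hg i hi).symm
  have hsum : ∑ _i ∈ univ.erase i₀, (1 : ZMod 2) = 0 := by
    refine sum_involution (fun i _ => g i) (fun _ _ => by decide) ?_ ?_ ?_
    · intro i hi _ e
      exact (hg i (ne_of_mem_erase hi)).1 (congrArg Fin.val e.symm)
    · intro i hi
      exact mem_erase.2 ⟨hg₀ i (ne_of_mem_erase hi), mem_univ _⟩
    · intro i hi
      have hi' := ne_of_mem_erase hi
      exact hC.eq_of_interleave hconv hn (hg _ (hg₀ i hi')) (hg i hi').symm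
  rw [sum_const, card_erase_of_mem (mem_univ _), card_univ, Fintype.card_fin, nsmul_one,
    ZMod.natCast_eq_zero_iff] at hsum
  obtain ⟨m, hm⟩ := heven
  omega

end
end

section
/- Let P = {v_0, v_1, …, v_{n−1}} be a set of n ≥ 4 points in convex position in the plane, and let C be a 1-plane Hamiltonian cycle on P whose boundary edges are exactly the two edges v_r v_{r+1} and v_s v_{s+1} (with r ≠ s). Then for each k ∈ {r, s}, both v_k v_{k+2} and v_{k+1} v_{k−1} are edges of C. -/
open Finset

noncomputable section

/-- The combinatorial content of a 1-plane Hamiltonian cycle on a convex `n`-gon, with the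
vertices unrolled to `ℤ`, so that integers congruent modulo `n` name the same vertex. -/
structure UnrolledCycle (n : ℤ) (A : ℤ → ℤ → Prop) : Prop where
  symm : ∀ {x y}, A x y → A y x
  periodic : ∀ {x y}, A x y ↔ A x (y + n)
  irrefl : ∀ x, ¬ A x x
  exists_adj : ∀ x, ∃ y, x ≤ y ∧ y < x + n ∧ A x y
  other : ∀ {x a} (w : ℤ), A x a → w ≤ a → a < w + n →
    ∃ b, w ≤ b ∧ b < w + n ∧ b ≠ a ∧ A x b
  degree : ∀ {x a b c}, A x a → A x b → A x c → a < b → b < c → c < a + n → False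
  /-- Removing two adjacent vertices leaves a path, which is connected. -/
  conn : ∀ {a b z w u v : ℤ}, a < z → z < b → b ≤ w → w ≤ a + n → b ≤ u → u ≤ a + n →
    b ≤ v → v ≤ a + n → A u v → w ≠ u → w ≠ v →
    (∀ x y, a < x → x < b → b ≤ y → y ≤ a + n → A x y → y = u ∨ y = v) → False
  crossing : ∀ {a b c d b' d' : ℤ}, a < b → b < c → c < d → d < a + n → A a c → A b d →
    a < b' → b' < c → c < d' → d' < a + n → A b' d' → b' = b ∧ d' = d

namespace UnrolledCycle

variable {n : ℤ} {A : ℤ → ℤ → Prop}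

theorem shift (h : UnrolledCycle n A) {x y x' y' : ℤ} (hA : A x y)
    (hx : x' = x ∨ x' = x + n ∨ x' = x - n) (hy : y' = y ∨ y' = y + n ∨ y' = y - n) :
    A x' y' := by
  have key : ∀ {x y y' : ℤ}, A x y → (y' = y ∨ y' = y + n ∨ y' = y - n) → A x y' := by
    intro x y y' hA hy
    rcases hy with rfl | rfl | rfl
    · exact hA
    · exact h.periodic.1 hA
    · exact h.periodic.2 (by simpa using hA)
  exact h.symm (key (h.symm (key hA hy)) hx)

theorem shift_symm (h : UnrolledCycle n A) {x y x' y' : ℤ} (hA : A x y)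
    (hx : x' = y ∨ x' = y + n ∨ x' = y - n) (hy : y' = x ∨ y' = x + n ∨ y' = x - n) :
    A x' y' :=
  h.shift (h.symm hA) hx hy

/-- Edges from inside an arc cut off by a crossing pair stay in that arc. -/
theorem eq_of_mem_arc (h : UnrolledCycle n A) {i c j d x y : ℤ} (hic : i < c) (hcj : c < j)
    (hjd : j < d) (hdi : d < i + n) (hij : A i j) (hcd : A c d) (hx : i < x) (hxc : x < c)
    (hcy : c ≤ y) (hyi : y ≤ i + n) (hxy : A x y) : y = c ∨ y = i + n := by
  by_contra! hne
  rcases lt_or_ge j y with hy | hy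
  · have := h.crossing (a := i) (b := c) (c := j) (d := d) (b' := x) (d' := y)
      hic hcj hjd hdi hij hcd (by omega) (by omega) (by omega) (by omega) hxy
    omega
  · have := h.crossing (a := c) (b := j) (c := d) (d := i + n) (b' := y) (d' := x + n)
      hcj hjd hdi (by omega) hcd (h.shift_symm hij (by omega) (by omega))
      (by omega) (by omega) (by omega) (by omega) (h.shift_symm hxy (by omega) (by omega))
    omega

/-- The neighbour of `c` off a crossing pair lies in one of the two arcs next to `c`. -/
theorem exists_other_mem (h : UnrolledCycle n A) {i c j d : ℤ} (hic : i < c) (hcj : c < j)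
    (hjd : j < d) (hdi : d < i + n) (hij : A i j) (hcd : A c d) :
    ∃ q, i ≤ q ∧ q ≤ j ∧ q ≠ c ∧ A c q := by
  obtain ⟨q, h1, h2, h3, h4⟩ := h.other i hcd (by omega) (by omega)
  refine ⟨q, h1, ?_, ?_, h4⟩
  · by_contra! hq
    have := h.crossing hic hcj hjd hdi hij hcd hic hcj hq h2 h4
    omega
  · rintro rfl
    exact h.irrefl _ h4

theorem arc_structure (h : UnrolledCycle n A) {i c j d p : ℤ} (hic : i < c) (hcj : c < j)
    (hjd : j < d) (hdi : d < i + n) (hij : A i j) (hcd : A c d) (hip : i < p) (hpc : p ≤ c)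
    (hp : A i p) :
    j = c + 1 ∧ d + 1 = i + n ∧ (∃ q, i ≤ q ∧ q < c ∧ A c q) ∧
      ∃ p', j < p' ∧ p' ≤ d ∧ A j p' := by
  obtain ⟨q, hiq, hqj, hqc, hq⟩ := h.exists_other_mem hic hcj hjd hdi hij hcd
  have hqc : q < c := by
    by_contra! hcq
    rcases eq_or_lt_of_le hpc with rfl | hpc
    · exact h.degree (h.symm hp) hq hcd (by omega) (by omega) (by omega)
    · refine h.conn (a := i) (b := c) (z := p) (w := c) (u := j) (v := i + n) hip hpc
        (by omega) (by omega) (by omega) (by omega) (by omega) (by omega)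
        (h.shift_symm hij (by omega) (by omega)) (by omega) (by omega) ?_
      intro x y h1 h2 h3 h4 hxy
      rcases h.eq_of_mem_arc hic hcj hjd hdi hij hcd h1 h2 h3 h4 hxy with rfl | rfl
      · exact (h.degree (h.symm hxy) hq hcd (by omega) (by omega) (by omega)).elim
      · exact Or.inr rfl
  have hij' : A j (i + n) := h.shift_symm hij (by omega) (by omega)
  have hj : j = c + 1 := by
    by_contra hj
    refine h.conn (a := c) (b := j) (z := c + 1) (w := c + n) (u := j) (v := i + n) (by omega)
      (by omega) (by omega) (by omega) (by omega) (by omega) (by omega) (by omega) hij'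
      (by omega) (by omega) ?_
    intro x y h1 h2 h3 h4 hxy
    rcases h.eq_of_mem_arc hcj hjd hdi (by omega) hcd hij' h1 h2 h3 h4 hxy with rfl | rfl
    · exact Or.inl rfl
    · have hx : A c x := h.shift_symm hxy (by omega) (by omega)
      exact (h.degree hq hx hcd (by omega) (by omega) (by omega)).elim
  refine ⟨hj, ?_, ⟨q, hiq, hqc, hq⟩, ?_⟩
  · by_contra hd
    refine h.conn (a := d) (b := i + n) (z := d + 1) (w := i + n) (u := c + n) (v := d + n)
      (by omega) (by omega) (by omega) (by omega) (by omega) (by omega) (by omega) (by omega)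
      (h.shift hcd (by omega) (by omega)) (by omega) (by omega) ?_
    intro x y h1 h2 h3 h4 hxy
    rcases h.eq_of_mem_arc (i := d) (c := i + n) (j := c + n) (d := j + n) hdi (by omega)
      (by omega) (by omega) (h.shift_symm hcd (by omega) (by omega))
      (h.shift hij (by omega) (by omega)) h1 h2 h3 h4 hxy with rfl | rfl
    · have hx : A i (x - n) := h.shift_symm hxy (by omega) (by omega)
      exact (h.degree hx hp hij (by omega) (by omega) (by omega)).elim
    · exact Or.inr rfl
  · obtain ⟨p', h1, h2, h3, h4⟩ := h.exists_other_mem hcj hjd hdi (by omega) hcd hij'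
    refine ⟨p', ?_, h2, h4⟩
    by_contra! hlt
    obtain rfl : p' = c := by omega
    exact h.degree hq (h.symm h4) hcd (by omega) (by omega) (by omega)

/-- The edges `i (c+1)` and `(i-1) c` cut off the arc from `i` to `c`, and the cycle enters this
arc at `i`. -/
def IsEar (n : ℤ) (A : ℤ → ℤ → Prop) (i c : ℤ) : Prop :=
  i < c ∧ c + 2 < i + n ∧ A i (c + 1) ∧ A (i - 1) c ∧ ∃ p, i < p ∧ p ≤ c ∧ A i p

theorem IsEar.exists_neighbors (h : UnrolledCycle n A) {i c : ℤ} (hG : IsEar n A i c) :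
    (∃ q, i ≤ q ∧ q < c ∧ A c q) ∧ ∃ p, c + 1 < p ∧ p ≤ i - 1 + n ∧ A (c + 1) p := by
  obtain ⟨h1, h2, h3, h4, p, h5, h6, h7⟩ := hG
  exact (h.arc_structure (i := i) (c := c) (j := c + 1) (d := i - 1 + n) h1 (by omega)
    (by omega) (by omega) h3 (h.shift_symm h4 (by omega) (by omega)) h5 h6 h7).2.2

theorem IsEar.opposite (h : UnrolledCycle n A) {i c : ℤ} (hG : IsEar n A i c) :
    IsEar n A (c + 1) (i - 1 + n) := by
  obtain ⟨-, p, h1, h2, h3⟩ := hG.exists_neighbors h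
  obtain ⟨h4, h5, h6, h7, -⟩ := hG
  exact ⟨by omega, by omega, h.shift_symm h6 (by omega) (by omega),
    h.shift_symm h7 (by omega) (by omega), p, h1, h2, h3⟩

theorem isEar_of_diagonal (h : UnrolledCycle n A) {a b : ℤ} (hab : a + 1 < b)
    (hba : b + 1 < a + n) (hA : A a b) : IsEar n A a (b - 1) ∨ IsEar n A (a + 1) b := by
  have hcross : ∃ x y, a < x ∧ x < b ∧ b < y ∧ y < a + n ∧ A x y := by
    by_contra! hno
    refine h.conn (a := a) (b := b) (z := a + 1) (w := b + 1) (u := b) (v := a + n)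
      (by omega) (by omega) (by omega) (by omega) (by omega) (by omega) (by omega) (by omega)
      (h.shift_symm hA (by omega) (by omega)) (by omega) (by omega) ?_
    intro x y h1 h2 h3 h4 hxy
    by_contra! hne
    exact hno x y h1 h2 (by omega) (by omega) hxy
  obtain ⟨x, y, hax, hxb, hby, hya, hxy⟩ := hcross
  have hxy' : A (y - n) x := h.shift_symm hxy (by omega) (by omega)
  have hba' : A b (a + n) := h.shift_symm hA (by omega) (by omega)
  obtain ⟨p, hp1, hp2, hp3, hp⟩ := h.exists_other_mem (i := y - n) (c := a) (j := x) (d := b)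
    (by omega) (by omega) (by omega) (by omega) hxy' hA
  rcases lt_or_gt_of_ne hp3 with hpa | hpa
  · obtain ⟨q, hq1, hq2, hq3, hq⟩ := h.exists_other_mem hax hxb hby hya hA hxy
    rcases lt_or_gt_of_ne hq3 with hqx | hqx
    · exfalso
      rcases eq_or_lt_of_le hq1 with rfl | haq
      · exact h.degree hp (h.symm hq) hA (by omega) (by omega) (by omega)
      · refine h.conn (a := a) (b := x) (z := q) (w := a + n) (u := x) (v := y) haq hqx
          (by omega) (by omega) (by omega) (by omega) (by omega) (by omega) hxy
          (by omega) (by omega) ?_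
        intro x' y' h1 h2 h3 h4 hxy'
        rcases h.eq_of_mem_arc hax hxb hby hya hA hxy h1 h2 h3 h4 hxy' with rfl | rfl
        · exact Or.inl rfl
        · have hx : A a x' := h.shift_symm hxy' (by omega) (by omega)
          exact (h.degree hp hx hA (by omega) (by omega) (by omega)).elim
    · obtain ⟨h1, h2, -⟩ := h.arc_structure hxb hby hya (by omega) hxy hba' hqx hq2 hq
      obtain rfl : x = a + 1 := by omega
      subst h1
      exact Or.inr ⟨hxb, by omega, hxy, by simpa using hA, q, hqx, hq2, hq⟩
  · obtain ⟨h1, h2, -⟩ := h.arc_structure hax hxb hby hya hA hxy hpa hp2 hp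
    subst h1
    refine Or.inl ⟨by omega, by omega, by simpa using hA,
      h.shift_symm hxy (by omega) (by omega), p, hpa, by omega, hp⟩

theorem IsEar.exists_boundary (h : UnrolledCycle n A) {i c : ℤ} (hG : IsEar n A i c) :
    (∃ m, i ≤ m ∧ m < c ∧ IsEar n A m (m + 1)) ∨
      ∃ m m', i ≤ m ∧ m < m' ∧ m' < c ∧ A m (m + 1) ∧ A m' (m' + 1) := by
  induction hk : (c - i).toNat using Nat.strong_induction_on generalizing i c with
  | _ k ih =>
  obtain ⟨⟨q, hiq, hqc, hq⟩, -⟩ := hG.exists_neighbors h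
  obtain ⟨h1, h2, h3, h4, p, hip, hpc, hp⟩ := id hG
  have h4' : A c (i - 1 + n) := h.shift_symm h4 (by omega) (by omega)
  rcases eq_or_lt_of_le hpc with rfl | hpc
  · by_cases hpi : p = i + 1
    · subst hpi
      exact Or.inl ⟨i, le_rfl, by omega, hG⟩
    · exfalso
      refine h.conn (a := i) (b := p) (z := i + 1) (w := p + 1) (u := p) (v := i + n)
        (by omega) (by omega) (by omega) (by omega) (by omega) (by omega) (by omega) (by omega)
        (h.shift_symm hp (by omega) (by omega)) (by omega) (by omega) ?_
      intro x y g1 g2 g3 g4 hxy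
      exact h.eq_of_mem_arc h1 (by omega) (by omega) (by omega) h3 h4' g1 g2 g3 g4 hxy
  · by_cases hpi : p = i + 1
    · subst hpi
      right
      by_cases hqc' : q = c - 1
      · subst hqc'
        exact ⟨i, c - 1, le_rfl, by omega, by omega, hp, h.shift_symm hq (by omega) (by omega)⟩
      · have hqi : q ≠ i := by
          rintro rfl
          exact h.degree hp (h.symm hq) h3 (by omega) (by omega) (by omega)
        rcases h.isEar_of_diagonal (a := q) (b := c) (by omega) (by omega) (h.symm hq)
          with hE | hE
        · rcases ih _ (by omega) hE rfl with ⟨m, g1, g2, g3⟩ | ⟨m, m', g1, g2, g3, g4, g5⟩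
          · obtain ⟨-, -, -, -, p', e1, e2, e3⟩ := g3
            obtain rfl : p' = m + 1 := by omega
            exact ⟨i, m, le_rfl, by omega, by omega, hp, e3⟩
          · exact ⟨m, m', by omega, g2, by omega, g4, g5⟩
        · exfalso
          have := h.crossing (a := c) (b := c + 1) (c := i - 1 + n) (d := i + n)
            (b' := c + 1) (d' := q + 1 + n) (by omega) (by omega) (by omega) (by omega) h4'
            (h.shift_symm h3 (by omega) (by omega)) (by omega) (by omega) (by omega) (by omega)
            (h.shift_symm hE.2.2.1 (by omega) (by omega))
          omega
    · rcases h.isEar_of_diagonal (a := i) (b := p) (by omega) (by omega) hp with hE | hE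
      · exfalso
        have := h.crossing (a := i) (b := c) (c := c + 1) (d := i - 1 + n)
            (b' := p - 1) (d' := i - 1 + n) (by omega) (by omega) (by omega) (by omega) h3
            h4' (by omega) (by omega) (by omega) (by omega)
            (h.shift_symm hE.2.2.2.1 (by omega) (by omega))
        omega
      · rcases ih _ (by omega) hE rfl with ⟨m, g1, g2, g3⟩ | ⟨m, m', g1, g2, g3, g4, g5⟩
        · exact Or.inl ⟨m, by omega, by omega, g3⟩
        · exact Or.inr ⟨m, m', by omega, g2, by omega, g4, g5⟩

theorem IsEar.boundary {m : ℤ} (hE : IsEar n A m (m + 1)) : A m (m + 1) := by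
  obtain ⟨-, -, -, -, p, h1, h2, h3⟩ := hE
  obtain rfl : p = m + 1 := by omega
  exact h3

theorem exists_diagonal (h : UnrolledCycle n A) (hn : 4 ≤ n)
    (hbd : ∀ {a b c}, A a (a + 1) → A b (b + 1) → A c (c + 1) → a < b → b < c → c < a + n →
      False) : ∃ a b, a + 1 < b ∧ b + 1 < a + n ∧ A a b := by
  by_contra! hno
  have key : ∀ x, A x (x + 1) := by
    intro x
    obtain ⟨y, h1, h2, h3⟩ := h.exists_adj x
    obtain ⟨b, g1, g2, g3, g4⟩ := h.other x h3 h1 h2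
    have hy : y ≠ x := by rintro rfl; exact h.irrefl _ h3
    have hb : b ≠ x := by rintro rfl; exact h.irrefl _ g4
    by_cases hy1 : y = x + 1
    · exact hy1 ▸ h3
    by_cases hb1 : b = x + 1
    · exact hb1 ▸ g4
    have hyn : ¬ y + 1 < x + n := fun hlt => hno x y (by omega) hlt h3
    have hbn : ¬ b + 1 < x + n := fun hlt => hno x b (by omega) hlt g4
    omega
  exact hbd (key 0) (key 1) (key 2) (by omega) (by omega) (by omega)

/-- If there are at most two boundary edges, then there are exactly two ears. -/
theorem exists_ears (h : UnrolledCycle n A) (hn : 4 ≤ n)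
    (hbd : ∀ {a b c}, A a (a + 1) → A b (b + 1) → A c (c + 1) → a < b → b < c → c < a + n →
      False) : ∃ m m', m < m' ∧ m' < m + n ∧ IsEar n A m (m + 1) ∧ IsEar n A m' (m' + 1) := by
  obtain ⟨i, c, hG⟩ : ∃ i c, IsEar n A i c := by
    obtain ⟨a, b, hab, hba, hA⟩ := h.exists_diagonal hn hbd
    rcases h.isEar_of_diagonal hab hba hA with hE | hE
    exacts [⟨_, _, hE⟩, ⟨_, _, hE⟩]
  rcases hG.exists_boundary h with ⟨m, h1, h2, h3⟩ | ⟨m, m', h1, h2, h3, h4, h5⟩ <;>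
  rcases (hG.opposite h).exists_boundary h with
    ⟨k, g1, g2, g3⟩ | ⟨k, k', g1, g2, g3, g4, g5⟩
  · exact ⟨m, k, by omega, by omega, h3, g3⟩
  · exact (hbd h3.boundary g4 g5 (by omega) (by omega) (by omega)).elim
  · exact (hbd h4 h5 g3.boundary (by omega) (by omega) (by omega)).elim
  · exact (hbd h4 h5 g4 (by omega) (by omega) (by omega)).elim

end UnrolledCycle

/-- The vertex of the `n`-gon named by an integer. -/
def unroll (n : ℕ) [NeZero n] (x : ℤ) : Fin n :=
  ⟨(x % n).toNat, by
    have h0 : 0 < n := Nat.pos_of_neZero n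
    have h1 := Int.emod_nonneg x (b := n) (by omega)
    have h2 := Int.emod_lt_of_pos x (b := n) (by omega)
    omega⟩

section unroll

variable {n : ℕ} [NeZero n]

theorem coe_unroll (x : ℤ) : ((unroll n x : ℕ) : ℤ) = x % n :=
  Int.toNat_of_nonneg (Int.emod_nonneg x (by exact_mod_cast NeZero.ne n))

theorem unroll_eq_iff {x y : ℤ} : unroll n x = unroll n y ↔ x % n = y % n := by
  rw [← coe_unroll, ← coe_unroll, Fin.ext_iff]
  norm_cast

theorem unroll_coe (k : Fin n) : unroll n (k : ℕ) = k := by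
  have h := coe_unroll (n := n) (k : ℕ)
  rw [Int.emod_eq_of_lt (by omega) (by have := k.2; omega)] at h
  exact Fin.ext (by exact_mod_cast h)

theorem unroll_add_self (x : ℤ) : unroll n (x + n) = unroll n x := by
  rw [unroll_eq_iff, Int.add_emod_right]

theorem unroll_add_one (x : ℤ) : unroll n (x + 1) = unroll n x + 1 := by
  rw [Fin.ext_iff]
  have h : ((unroll n (x + 1) : ℕ) : ℤ) = ((unroll n x + 1 : Fin n) : ℕ) := by
    rw [coe_unroll, Fin.val_add, Fin.val_one']
    push_cast
    rw [coe_unroll]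
    simp
  exact_mod_cast h

theorem unroll_sub_one (x : ℤ) : unroll n (x - 1) = unroll n x - 1 := by
  have h := unroll_add_one (n := n) (x - 1)
  rw [sub_add_cancel] at h
  rw [h, add_sub_cancel_right]

theorem unroll_ne {x y : ℤ} (h : x < y) (h' : y < x + n) : unroll n x ≠ unroll n y := by
  intro he
  rw [unroll_eq_iff] at he
  have hd : (n : ℤ) ∣ y - x := Int.ModEq.dvd he
  exact absurd (Int.le_of_dvd (by omega) hd) (by omega)

theorem unroll_injOn {w x y : ℤ} (hx : w ≤ x) (hx' : x < w + n) (hy : w ≤ y) (hy' : y < w + n)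
    (h : unroll n x = unroll n y) : x = y := by
  rcases lt_trichotomy x y with hlt | rfl | hlt
  · exact absurd h (unroll_ne hlt (by omega))
  · rfl
  · exact absurd h.symm (unroll_ne hlt (by omega))

theorem exists_unroll (w : ℤ) (k : Fin n) : ∃ x, w ≤ x ∧ x < w + n ∧ unroll n x = k := by
  have h0 : (0 : ℤ) < n := by exact_mod_cast Nat.pos_of_neZero n
  refine ⟨w + ((k : ℕ) - w) % n, ?_, ?_, ?_⟩
  · have := Int.emod_nonneg ((k : ℕ) - w) h0.ne'
    omega
  · have := Int.emod_lt_of_pos ((k : ℕ) - w) h0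
    omega
  · conv_rhs => rw [← unroll_coe k]
    rw [unroll_eq_iff, Int.add_emod_emod, add_sub_cancel]

end unroll

section geometry

variable {n : ℕ} {v : Fin n → Pt}

theorem EdgesCross.symm {e f : Sym2 (Fin n)} (h : EdgesCross v e f) : EdgesCross v f e :=
  ⟨fun a hf he => h.1 a he hf, by rw [Set.inter_comm]; exact h.2⟩

theorem ConvexCcw.edgesCross_of_lt (hv : ConvexCcw v) {i j k l : Fin n} (hij : i < j)
    (hjk : j < k) (hkl : k < l) : EdgesCross v s(i, k) s(j, l) := by
  refine ⟨?_, ?_⟩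
  · intro a ha hb
    rw [Sym2.mem_iff] at ha hb
    omega
  have h1 := hv i j k hij hjk
  have h2 := hv i k l (hij.trans hjk) hkl
  have h3 := hv i j l hij (hjk.trans hkl)
  have h4 := hv j k l hjk hkl
  unfold Ccw at h1 h2 h3 h4
  set D₁ := (v j 0 - v i 0) * (v k 1 - v i 1) - (v j 1 - v i 1) * (v k 0 - v i 0) with e1
  set D₂ := (v k 0 - v i 0) * (v l 1 - v i 1) - (v k 1 - v i 1) * (v l 0 - v i 0) with e2
  set D₃ := (v j 0 - v i 0) * (v l 1 - v i 1) - (v j 1 - v i 1) * (v l 0 - v i 0) with e3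
  set D₄ := (v k 0 - v j 0) * (v l 1 - v j 1) - (v k 1 - v j 1) * (v l 0 - v j 0) with e4
  have hD : D₁ + D₂ = D₃ + D₄ := by rw [e1, e2, e3, e4]; ring
  have hpos : 0 < D₃ + D₄ := by positivity
  refine ⟨(D₄ / (D₃ + D₄)) • v i + (D₃ / (D₃ + D₄)) • v k, ?_, ?_⟩
  · exact ⟨_, _, by positivity, by positivity, by field_simp; ring, rfl⟩
  · refine ⟨D₂ / (D₃ + D₄), D₁ / (D₃ + D₄), by positivity, by positivity, ?_, ?_⟩
    · field_simp
      linarith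
    · ext t
      fin_cases t <;> simp <;> field_simp <;> rw [e1, e2, e3, e4] <;> ring

theorem ConvexCcw.edgesCross_unroll [NeZero n] (hv : ConvexCcw v) {a b c d : ℤ} (hab : a < b)
    (hbc : b < c) (hcd : c < d) (hda : d < a + n) :
    EdgesCross v s(unroll n a, unroll n c) s(unroll n b, unroll n d) := by
  have base : ∀ {a b c d : ℤ}, 0 ≤ a → a < b → b < c → c < d → d < n →
      EdgesCross v s(unroll n a, unroll n c) s(unroll n b, unroll n d) := by
    intro a b c d h0 hab hbc hcd hdn
    have lt : ∀ {x y : ℤ}, 0 ≤ x → x < y → y < n → unroll n x < unroll n y := by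
      intro x y hx hxy hy
      have h1 := coe_unroll (n := n) x
      have h2 := coe_unroll (n := n) y
      rw [Int.emod_eq_of_lt (by omega) (by omega)] at h1 h2
      rw [Fin.lt_def]
      omega
    exact hv.edgesCross_of_lt (lt (by omega) hab (by omega)) (lt (by omega) hbc (by omega))
      (lt (by omega) hcd (by omega))
  have step : ∀ {a b c d : ℤ}, 0 ≤ a → a < n → a < b → b < c → c < d → d < a + n →
      EdgesCross v s(unroll n a, unroll n c) s(unroll n b, unroll n d) := by
    intro a b c d h0 han hab hbc hcd hda
    have red : ∀ x : ℤ, unroll n x = unroll n (x - n) := fun x => by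
      conv_lhs => rw [← sub_add_cancel x (n : ℤ), unroll_add_self]
    rcases lt_or_ge d n with hd | hd
    · exact base h0 hab hbc hcd hd
    rw [red d]
    rcases lt_or_ge c n with hc | hc
    · rw [Sym2.eq_swap (a := unroll n b)]
      exact (base (by omega) (by omega) (by omega) (by omega) (by omega)).symm
    rw [red c, Sym2.eq_swap (a := unroll n a)]
    rcases lt_or_ge b n with hb | hb
    · rw [Sym2.eq_swap (a := unroll n b)]
      exact base (by omega) (by omega) (by omega) (by omega) (by omega)
    · rw [red b]
      exact (base (by omega) (by omega) (by omega) (by omega) (by omega)).symm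
  have h0 : (0 : ℤ) < n := by exact_mod_cast Nat.pos_of_neZero n
  have hsub : ∀ x, unroll n x = unroll n (x - n * (a / n)) := fun x => by
    rw [unroll_eq_iff, Int.sub_mul_emod_self_left]
  have h1 := Int.emod_add_mul_ediv a n
  have h2 := Int.emod_nonneg a h0.ne'
  have h3 := Int.emod_lt_of_pos a h0
  rw [hsub a, hsub b, hsub c, hsub d]
  generalize (n : ℤ) * (a / n) = t at *
  exact step (by omega) (by omega) (by omega) (by omega) (by omega) (by omega)

end geometry

section hamiltonian

variable {n : ℕ} {σ : Equiv.Perm (Fin n)}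

theorem mem_cycEdges_iff {x y : Fin n} : s(x, y) ∈ cycEdges σ ↔ y = σ x ∨ x = σ y := by
  constructor
  · rintro ⟨i, hi⟩
    rcases Sym2.eq_iff.1 hi with ⟨rfl, rfl⟩ | ⟨rfl, rfl⟩
    · exact Or.inl rfl
    · exact Or.inr rfl
  · rintro (rfl | rfl)
    · exact ⟨x, rfl⟩
    · exact ⟨y, Sym2.eq_swap⟩

theorem IsHamCycle.apply_ne_s4 (hσ : IsHamCycle σ) (x : Fin n) : σ x ≠ x := by
  rw [← Equiv.Perm.mem_support, hσ.2]
  exact Finset.mem_univ x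

theorem IsHamCycle.mem_of_closed_s4 (hσ : IsHamCycle σ) {S : Set (Fin n)}
    (hS : ∀ x ∈ S, σ x ∈ S) {x : Fin n} (hx : x ∈ S) (y : Fin n) : y ∈ S := by
  obtain ⟨k, rfl⟩ := hσ.1.exists_pow_eq (hσ.apply_ne_s4 x) (hσ.apply_ne_s4 y)
  induction k with
  | zero => simpa using hx
  | succ k ih =>
    rw [pow_succ', Equiv.Perm.mul_apply]
    exact hS _ ih

theorem IsHamCycle.apply_apply_ne_s4 (hσ : IsHamCycle σ) (hn : 3 ≤ n) (x : Fin n) :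
    σ (σ x) ≠ x := by
  intro he
  have hall : ∀ y, y ∈ ({x, σ x} : Finset (Fin n)) := by
    intro y
    have := hσ.mem_of_closed_s4 (S := {x, σ x}) (by
      rintro z (rfl | rfl)
      · exact Or.inr rfl
      · exact Or.inl he) (Or.inl rfl) y
    simpa using this
  have h1 : (Finset.univ : Finset (Fin n)).card ≤ ({x, σ x} : Finset (Fin n)).card :=
    Finset.card_le_card fun y _ => hall y
  have h2 := Finset.card_le_two (a := x) (b := σ x)
  rw [Finset.card_univ, Fintype.card_fin] at h1
  omega

/-- Deleting two consecutive vertices of a Hamiltonian cycle leaves a connected path. -/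
theorem IsHamCycle.not_separated (hσ : IsHamCycle σ) {S : Set (Fin n)} {u v z w : Fin n}
    (huv : s(u, v) ∈ cycEdges σ) (hu : u ∉ S) (hv : v ∉ S) (hz : z ∈ S) (hw : w ∉ S)
    (hwu : w ≠ u) (hwv : w ≠ v)
    (hS : ∀ x ∈ S, ∀ y ∉ S, s(x, y) ∈ cycEdges σ → y = u ∨ y = v) : False := by
  wlog hs : v = σ u generalizing u v with H
  · refine H (Sym2.eq_swap ▸ huv) hv hu hwv hwu (fun x hx y hy hxy => (hS x hx y hy hxy).symm) ?_
    exact (mem_cycEdges_iff.1 huv).resolve_left hs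
  subst hs
  by_cases hσS : σ (σ u) ∈ S
  · have := hσ.mem_of_closed_s4 (S := {x | x ∈ S ∨ x = u ∨ x = σ u}) (by
      rintro x (hx | rfl | rfl)
      · by_cases hx' : σ x ∈ S
        · exact Or.inl hx'
        · exact Or.inr (hS x hx _ hx' ⟨x, rfl⟩)
      · exact Or.inr (Or.inr rfl)
      · exact Or.inl hσS) (Or.inl hz) w
    rcases this with h | h | h
    exacts [hw h, hwu h, hwv h]
  · have := hσ.mem_of_closed_s4 (S := Sᶜ) (by
      intro x hx hx'
      rcases hS _ hx' x hx ⟨x, Sym2.eq_swap⟩ with rfl | rfl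
      · exact hv hx'
      · exact hσS hx') hw z
    exact this hz

end hamiltonian

theorem IsOnePlaneHC.unrolledCycle {n : ℕ} [NeZero n] (hn : 4 ≤ n) {v : Fin n → Pt}
    (hv : ConvexCcw v) {σ : Equiv.Perm (Fin n)} (hC : IsOnePlaneHC v σ) :
    UnrolledCycle n fun x y => s(unroll n x, unroll n y) ∈ cycEdges σ where
  symm h := Sym2.eq_swap ▸ h
  periodic {x y} := by rw [unroll_add_self]
  irrefl x h := by
    rcases mem_cycEdges_iff.1 h with h | h <;> exact hC.1.apply_ne_s4 _ h.symm
  exists_adj x := by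
    obtain ⟨y, h1, h2, h3⟩ := exists_unroll x (σ (unroll n x))
    exact ⟨y, h1, h2, unroll n x, by rw [h3]⟩
  other {x a} w h _ _ := by
    have hne := hC.1.apply_apply_ne_s4 (by omega)
    rcases mem_cycEdges_iff.1 h with h | h
    · obtain ⟨b, h1, h2, h3⟩ := exists_unroll w (σ.symm (unroll n x))
      refine ⟨b, h1, h2, ?_, mem_cycEdges_iff.2 (Or.inr (by rw [h3]; simp))⟩
      rintro rfl
      apply hne (unroll n b)
      rw [h3, Equiv.apply_symm_apply, ← h, h3]
    · obtain ⟨b, h1, h2, h3⟩ := exists_unroll w (σ (unroll n x))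
      refine ⟨b, h1, h2, ?_, mem_cycEdges_iff.2 (Or.inl h3)⟩
      rintro rfl
      exact hne (unroll n b) (by rw [← h, ← h3])
  degree {x a b c} ha hb hc hab hbc hca := by
    have h1 : unroll n a ≠ unroll n b := unroll_ne hab (by omega)
    have h2 : unroll n b ≠ unroll n c := unroll_ne hbc (by omega)
    have h3 : unroll n a ≠ unroll n c := unroll_ne (by omega) hca
    rw [mem_cycEdges_iff] at ha hb hc
    rcases ha with ha | ha <;> rcases hb with hb | hb <;> rcases hc with hc | hc
    all_goals first
      | exact h1 (ha.trans hb.symm)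
      | exact h2 (hb.trans hc.symm)
      | exact h3 (ha.trans hc.symm)
      | exact h1 (σ.injective (ha.symm.trans hb))
      | exact h2 (σ.injective (hb.symm.trans hc))
      | exact h3 (σ.injective (ha.symm.trans hc))
  conn {a b z w u v'} haz hzb hbw hwa hbu hua hbv hva huv hwu hwv hS := by
    have out : ∀ y, b ≤ y → y ≤ a + n → unroll n y ∉ unroll n '' Set.Ioo a b := by
      rintro y h1 h2 ⟨x, ⟨h3, h4⟩, he⟩
      exact unroll_ne (by omega) (by omega) he
    have inj : ∀ {x y}, b ≤ x → x ≤ a + n → b ≤ y → y ≤ a + n → x ≠ y →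
        unroll n x ≠ unroll n y := fun h1 h2 h3 h4 hne he =>
      hne (unroll_injOn h1 (by omega) h3 (by omega) he)
    refine hC.1.not_separated (S := unroll n '' Set.Ioo a b) huv (out u hbu hua)
      (out v' hbv hva) ⟨z, ⟨haz, hzb⟩, rfl⟩ (out w hbw hwa) (inj hbw hwa hbu hua hwu)
      (inj hbw hwa hbv hva hwv) ?_
    rintro _ ⟨x, ⟨h1, h2⟩, rfl⟩ k hk hxk
    obtain ⟨y, g1, g2, rfl⟩ := exists_unroll (a + 1) k
    have hby : b ≤ y := by
      by_contra! hlt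
      exact hk ⟨y, ⟨by omega, hlt⟩, rfl⟩
    rcases hS x y h1 h2 hby (by omega) hxk with rfl | rfl
    exacts [Or.inl rfl, Or.inr rfl]
  crossing {a b c d b' d'} hab hbc hcd hda hac hbd hab' hbc' hcd' hda' hbd' := by
    have he := hC.2 _ hac ⟨hbd', hv.edgesCross_unroll hab' hbc' hcd' hda'⟩
      ⟨hbd, hv.edgesCross_unroll hab hbc hcd hda⟩
    rcases Sym2.eq_iff.1 he with ⟨h1, h2⟩ | ⟨h1, h2⟩
    · exact ⟨unroll_injOn (w := a) (by omega) (by omega) (by omega) (by omega) h1,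
        unroll_injOn (w := a) (by omega) (by omega) (by omega) (by omega) h2⟩
    · have := unroll_injOn (w := a) (by omega) (by omega) (by omega) (by omega) h1
      omega

/-- if a 1-plane Hamiltonian cycle on `n ≥ 4` points in convex
position has exactly the two boundary edges `v_r v_{r+1}` and `v_s v_{s+1}`
(`r ≠ s`), then for each `k ∈ {r, s}` both `v_k v_{k+2}` and `v_{k+1} v_{k-1}`
are edges of the cycle. -/
theorem stmt4 {n : ℕ} [NeZero n] (hn : 4 ≤ n) (v : Fin n → Pt)
    (hconv : ConvexCcw v) (σ : Equiv.Perm (Fin n)) (hC : IsOnePlaneHC v σ)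
    (r s : Fin n) (hrs : r ≠ s)
    (hbd : ∀ k : Fin n, s(k, k + 1) ∈ cycEdges σ ↔ k = r ∨ k = s) :
    ∀ k : Fin n, k = r ∨ k = s →
      s(k, k + 1 + 1) ∈ cycEdges σ ∧ s(k + 1, k - 1) ∈ cycEdges σ := by
  have hU := hC.unrolledCycle hn hconv
  have hbd' : ∀ {a b c : ℤ}, s(unroll n a, unroll n (a + 1)) ∈ cycEdges σ →
      s(unroll n b, unroll n (b + 1)) ∈ cycEdges σ →
      s(unroll n c, unroll n (c + 1)) ∈ cycEdges σ → a < b → b < c → c < a + n → False := by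
    intro a b c ha hb hc hab hbc hca
    have h1 : unroll n a ≠ unroll n b := unroll_ne hab (by omega)
    have h2 : unroll n b ≠ unroll n c := unroll_ne hbc (by omega)
    have h3 : unroll n a ≠ unroll n c := unroll_ne (by omega) hca
    rw [unroll_add_one, hbd] at ha hb hc
    omega
  obtain ⟨m, m', h1, h2, hE, hE'⟩ := hU.exists_ears (by omega) hbd'
  have ear : ∀ {m : ℤ}, UnrolledCycle.IsEar n
      (fun x y => s(unroll n x, unroll n y) ∈ cycEdges σ) m (m + 1) →
      s(unroll n m, unroll n m + 1 + 1) ∈ cycEdges σ ∧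
        s(unroll n m + 1, unroll n m - 1) ∈ cycEdges σ := by
    intro m hE
    rw [← unroll_add_one, ← unroll_add_one, ← unroll_sub_one]
    exact ⟨hE.2.2.1, hU.symm hE.2.2.2.1⟩
  have hm := hE.boundary
  have hm' := hE'.boundary
  simp only [unroll_add_one, hbd] at hm hm'
  have hne : unroll n m ≠ unroll n m' := unroll_ne h1 h2
  intro k hk
  obtain rfl | rfl : k = unroll n m ∨ k = unroll n m' := by omega
  exacts [ear hE, ear hE']

end
end
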